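/- Let X_λ ~ Gamma(2κλ^{1−α}/σ², 2κ/(σ²λ^α)) for each λ > 0, with fixed κ > 0, σ > 0 and 0 ≤ α < 1. Then the scaled variable λ^{−(α+1)/2}(X_λ − λ) converges in distribution, as λ → ∞, to a normal distribution with mean 0 and variance σ²/(2κ). -/

import Mathlib

open MeasureTheory ProbabilityTheory Real Filter
open Topology

lemma gamma_integral_exp {a r t : ℝ} (ha : 0 < a) (hr : 0 < r) (ht : t < r) :
    ∫ x, rexp (t * x) ∂(gammaMeasure a r) = rexp (-a * Real.log (1 - t / r)) := by
  have hrt : 0 < r - t := by linarith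
  rw [gammaMeasure, integral_withDensity_eq_integral_toReal_smul
    (by unfold gammaPDF; fun_prop) (by simp [gammaPDF])]
  have h1 : ∀ x, (gammaPDF a r x).toReal • rexp (t * x)
      = (Set.Ici (0:ℝ)).indicator
        (fun x => r ^ a / Real.Gamma a * (x ^ (a - 1) * rexp (-((r - t) * x)))) x := by
    intro x
    rw [gammaPDF, ENNReal.toReal_ofReal (gammaPDFReal_nonneg ha hr x), gammaPDFReal]
    by_cases hx : 0 ≤ x
    · rw [if_pos hx, Set.indicator_of_mem (by exact hx), smul_eq_mul, mul_assoc, mul_assoc,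
        ← Real.exp_add]
      ring_nf
    · rw [if_neg hx, Set.indicator_of_notMem (by exact hx), zero_smul]
  simp_rw [h1]
  rw [integral_indicator measurableSet_Ici, integral_Ici_eq_integral_Ioi, integral_const_mul,
    Real.integral_rpow_mul_exp_neg_mul_Ioi ha hrt]
  have hG := (Real.Gamma_pos_of_pos ha).ne'
  have h2 : 1 - t / r = (r - t) / r := by field_simp
  rw [h2, Real.log_div hrt.ne' hr.ne', Real.rpow_def_of_pos hr, Real.rpow_def_of_pos (by positivity),
    Real.log_div one_ne_zero hrt.ne', Real.log_one]
  field_simp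
  rw [← Real.exp_add]
  ring_nf

lemma gamma_charFun {a r : ℝ} (ha : 0 < a) (hr : 0 < r) (t : ℝ) :
    charFun (gammaMeasure a r) t
      = Complex.exp (-a * Complex.log (1 + (-(Complex.I * t / r)))) := by
  have hint : ∀ s < r, s ∈ integrableExpSet id (gammaMeasure a r) := by
    intro s hs
    refine Integrable.of_integral_ne_zero ?_
    simp only [id]
    rw [gamma_integral_exp ha hr hs]
    positivity
  have hsub : Set.Iio r ⊆ interior (integrableExpSet id (gammaMeasure a r)) :=
    interior_maximal hint isOpen_Iio
  have hA : AnalyticOnNhd ℂ (complexMGF id (gammaMeasure a r)) {z | z.re < r} :=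
    analyticOnNhd_complexMGF.mono fun z hz => hsub hz
  have hopen : IsOpen {z : ℂ | z.re < r} := isOpen_lt Complex.continuous_re continuous_const
  have hB : AnalyticOnNhd ℂ (fun z : ℂ => Complex.exp (-a * Complex.log (1 + (-(z / r)))))
      {z | z.re < r} := by
    refine DifferentiableOn.analyticOnNhd (fun z hz => ?_) hopen
    refine DifferentiableAt.differentiableWithinAt ?_
    have hs : 1 + (-(z / r)) ∈ Complex.slitPlane := by
      left
      have : z.re < r := hz
      have h3 : z.re / r < 1 := by rwa [div_lt_one hr]
      simp only [Complex.add_re, Complex.one_re, Complex.neg_re, Complex.div_ofReal_re]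
      linarith
    have hd : DifferentiableAt ℂ (fun z : ℂ => 1 + (-(z / r))) z := by fun_prop
    exact ((hd.clog hs).const_mul _).cexp
  have hpre : IsPreconnected {z : ℂ | z.re < r} :=
    (convex_halfSpace_re_lt r).isPreconnected
  have hfreq : ∃ᶠ z in nhdsWithin (0:ℂ) {0}ᶜ, complexMGF id (gammaMeasure a r) z
      = Complex.exp (-a * Complex.log (1 + (-(z / r)))) := by
    have htd : Tendsto (fun x : ℝ => (x : ℂ)) (nhdsWithin 0 {0}ᶜ) (nhdsWithin 0 {0}ᶜ) := by
      refine tendsto_nhdsWithin_iff.2 ⟨?_, ?_⟩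
      · exact (Complex.continuous_ofReal.tendsto' 0 0 (by simp)).mono_left nhdsWithin_le_nhds
      · filter_upwards [self_mem_nhdsWithin] with x hx
        simpa using hx
    refine htd.frequently (Eventually.frequently ?_)
    filter_upwards [nhdsWithin_le_nhds (Iio_mem_nhds hr)] with x hx
    have hx' : x < r := hx
    rw [complexMGF_ofReal, mgf]
    simp only [id]
    rw [gamma_integral_exp ha hr hx', Complex.ofReal_exp]
    have : 0 ≤ 1 - x / r := by
      have : x / r < 1 := by rwa [div_lt_one hr]
      linarith
    rw [Complex.ofReal_mul, Complex.ofReal_log this]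
    push_cast
    rw [← sub_eq_add_neg]
  have := hA.eqOn_of_preconnected_of_frequently_eq hB hpre (z₀ := 0) (by simpa using hr) hfreq
  rw [← complexMGF_id_mul_I, this (by simpa using hr)]
  simp only [mul_comm]

lemma charFun_affine (μ : Measure ℝ) (s l t : ℝ) :
    charFun (μ.map (fun x => s * (x - l))) t
      = Complex.exp (-(Complex.I * t * s * l)) * charFun μ (t * s) := by
  rw [charFun_apply_real, charFun_apply_real, integral_map (by fun_prop) (by fun_prop),
    ← integral_const_mul]
  congr 1
  ext x
  rw [← Complex.exp_add]
  congr 1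
  push_cast
  ring

lemma gamma_limit (A : ℝ → ℝ) (z : ℝ → ℂ) (c : ℂ) (hz : Tendsto z atTop (𝓝 0))
    (hc : ∀ᶠ x in atTop, A x * z x ^ 2 = c) :
    Tendsto (fun x => A x * z x + -A x * Complex.log (1 + z x)) atTop (𝓝 (c / 2)) := by
  have hn : Tendsto (fun x => ‖z x‖) atTop (𝓝 0) := by simpa using hz.norm
  rw [tendsto_iff_norm_sub_tendsto_zero]
  have hlim : Tendsto (fun x => ‖c‖ * ‖z x‖) atTop (𝓝 0) := by simpa using hn.const_mul ‖c‖
  refine squeeze_zero' (Eventually.of_forall fun _ => norm_nonneg _) ?_ hlim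
  filter_upwards [hc, hn.eventually (gt_mem_nhds (show (0:ℝ) < 1/2 by norm_num))] with x hx hx2
  have hb := Complex.norm_log_sub_logTaylor_le 2 (z := z x) (by linarith)
  have hT : Complex.logTaylor 3 (z x) = z x - z x ^ 2 / 2 := by
    simp [Complex.logTaylor_succ, Complex.logTaylor_zero]
    ring
  rw [show 2 + 1 = 3 from rfl, hT] at hb
  have he : A x * z x + -A x * Complex.log (1 + z x) - c / 2
      = -(A x * (Complex.log (1 + z x) - (z x - z x ^ 2 / 2))) := by
    rw [← hx]; ring
  rw [he, norm_neg, norm_mul, ← hx, norm_mul, norm_pow, mul_assoc]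
  refine mul_le_mul_of_nonneg_left (hb.trans ?_) (norm_nonneg _)
  have h1 : (1 - ‖z x‖)⁻¹ ≤ 2 := by
    rw [inv_le_comm₀ (by linarith) (by norm_num)]; linarith
  have h0 : 0 ≤ ‖z x‖ ^ 3 := by positivity
  have := mul_le_mul_of_nonneg_left h1 h0
  push_cast
  nlinarith

theorem gamma_clt_to_gaussian
    (κ σ α : ℝ) (hκ : 0 < κ) (hσ : 0 < σ) (hα₀ : 0 ≤ α) (hα₁ : α < 1) :
    ∀ f : BoundedContinuousFunction ℝ ℝ,
      Tendsto
        (fun lam : ℝ => ∫ y, f y ∂(Measure.map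
            (fun x => lam ^ (-(α + 1) / 2) * (x - lam))
            (gammaMeasure (2 * κ * lam ^ ((1:ℝ) - α) / σ ^ 2)
              (2 * κ / (σ ^ 2 * lam ^ α)))))
        atTop
        (nhds (∫ y, f y ∂(gaussianReal 0 (Real.toNNReal (σ ^ 2 / (2 * κ)))))) := by
  intro f
  set μ : ℝ → Measure ℝ := fun lam => Measure.map
            (fun x => lam ^ (-(α + 1) / 2) * (x - lam))
            (gammaMeasure (2 * κ * lam ^ ((1:ℝ) - α) / σ ^ 2)
              (2 * κ / (σ ^ 2 * lam ^ α))) with hμ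
  have hprob : ∀ lam, 0 < lam → IsProbabilityMeasure (μ lam) := by
    intro lam hl
    have := isProbabilityMeasure_gammaMeasure (a := 2 * κ * lam ^ ((1:ℝ) - α) / σ ^ 2)
      (r := 2 * κ / (σ ^ 2 * lam ^ α)) (by positivity) (by positivity)
    exact Measure.isProbabilityMeasure_map (by fun_prop)
  -- the characteristic functions converge
  have hchar : ∀ t : ℝ, Tendsto (fun lam => charFun (μ lam) t) atTop
      (𝓝 (charFun (gaussianReal 0 (Real.toNNReal (σ ^ 2 / (2 * κ)))) t)) := by
    intro t
    set z : ℝ → ℂ := fun lam =>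
      ((-(t * (σ ^ 2 / (2 * κ)) * lam ^ (-((1 - α) / 2))) : ℝ) : ℂ) * Complex.I with hzdef
    have hz : Tendsto z atTop (𝓝 0) := by
      have h1 := tendsto_rpow_neg_atTop (show 0 < (1 - α) / 2 by linarith)
      have h2 : Tendsto (fun lam : ℝ => -(t * (σ ^ 2 / (2 * κ)) * lam ^ (-((1 - α) / 2))))
          atTop (𝓝 0) := by
        simpa using (h1.const_mul (t * (σ ^ 2 / (2 * κ)))).neg
      have h3 := (Complex.continuous_ofReal.tendsto 0).comp h2
      simpa [hzdef, Function.comp_def] using h3.mul_const Complex.I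
    have hlim := gamma_limit (fun lam => 2 * κ * lam ^ ((1:ℝ) - α) / σ ^ 2) z
      ((-(t ^ 2 * (σ ^ 2 / (2 * κ))) : ℝ) : ℂ) hz (by
        filter_upwards [eventually_gt_atTop 0] with lam hl
        rw [hzdef]
        simp only
        rw [mul_pow, Complex.I_sq, mul_neg_one, mul_neg, ← Complex.ofReal_pow,
          ← Complex.ofReal_mul, ← Complex.ofReal_neg]
        congr 1
        have : lam ^ ((1:ℝ) - α) * (lam ^ (-((1 - α) / 2))) ^ 2 = 1 := by
          rw [← Real.rpow_natCast, ← Real.rpow_mul hl.le, ← Real.rpow_add hl]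
          convert Real.rpow_zero lam using 2
          push_cast; ring
        calc -(2 * κ * lam ^ (1 - α) / σ ^ 2 * (-(t * (σ ^ 2 / (2 * κ)) * lam ^ (-((1 - α) / 2)))) ^ 2)
            = -(2 * κ / σ ^ 2 * (t * (σ ^ 2 / (2 * κ))) ^ 2
              * (lam ^ ((1:ℝ) - α) * (lam ^ (-((1 - α) / 2))) ^ 2)) := by ring
          _ = _ := by rw [this]; field_simp)
    have hexp := (Complex.continuous_exp.tendsto _).comp hlim
    have hg : charFun (gaussianReal 0 (Real.toNNReal (σ ^ 2 / (2 * κ)))) t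
        = Complex.exp (((-(t ^ 2 * (σ ^ 2 / (2 * κ))) : ℝ) : ℂ) / 2) := by
      rw [charFun_gaussianReal]
      congr 1
      rw [Real.coe_toNNReal _ (by positivity)]
      push_cast; ring
    rw [hg]
    refine hexp.congr' ?_
    filter_upwards [eventually_gt_atTop 0] with lam hl
    rw [hμ]
    simp only [Function.comp]
    rw [charFun_affine, gamma_charFun (by positivity) (by positivity), ← Complex.exp_add]
    have hp1 : lam ^ (-(α + 1) / 2) * lam ^ α = lam ^ (-((1 - α) / 2)) := by
      rw [← Real.rpow_add hl]; congr 1; ring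
    have hp2 : lam ^ ((1:ℝ) - α) * lam ^ (-((1 - α) / 2)) = lam ^ (-(α + 1) / 2) * lam := by
      rw [← Real.rpow_add hl]
      nth_rewrite 3 [← Real.rpow_one lam]
      rw [← Real.rpow_add hl]; congr 1; ring
    have e1 : -(Complex.I * ((t * lam ^ (-(α + 1) / 2) : ℝ) : ℂ)
        / ((2 * κ / (σ ^ 2 * lam ^ α) : ℝ) : ℂ)) = z lam := by
      rw [mul_div_assoc, ← Complex.ofReal_div, hzdef]
      simp only
      rw [← hp1, mul_comm Complex.I, ← neg_mul, ← Complex.ofReal_neg]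
      congr 3
      field_simp
    have e2 : ((2 * κ * lam ^ ((1:ℝ) - α) / σ ^ 2 : ℝ) : ℂ) * z lam
        = -(Complex.I * t * ((lam ^ (-(α + 1) / 2) : ℝ) : ℂ) * lam) := by
      rw [hzdef]
      simp only
      rw [← mul_assoc, ← Complex.ofReal_mul]
      have : 2 * κ * lam ^ ((1:ℝ) - α) / σ ^ 2 * -(t * (σ ^ 2 / (2 * κ)) * lam ^ (-((1 - α) / 2)))
          = -(t * (lam ^ (-(α + 1) / 2) * lam)) := by
        rw [← hp2]; field_simp
      rw [this]
      push_cast; ring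
    rw [e1, e2]
  -- pass to sequences and apply Lévy
  refine tendsto_of_seq_tendsto fun u hu => ?_
  set v : ℕ → ℝ := fun n => max (u n) 1 with hv
  have hvu : ∀ᶠ n in atTop, v n = u n := by
    filter_upwards [hu.eventually_ge_atTop 1] with n hn
    exact max_eq_left hn
  have hvt : Tendsto v atTop atTop := hu.congr' (hvu.mono fun n h => h.symm)
  have hvpos : ∀ n, 0 < v n := fun n => lt_of_lt_of_le one_pos (le_max_right _ _)
  let P : ℕ → ProbabilityMeasure ℝ := fun n => ⟨μ (v n), hprob _ (hvpos n)⟩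
  let P0 : ProbabilityMeasure ℝ :=
    ⟨gaussianReal 0 (Real.toNNReal (σ ^ 2 / (2 * κ))), inferInstance⟩
  have hP : Tendsto P atTop (𝓝 P0) :=
    ProbabilityMeasure.tendsto_of_tendsto_charFun fun t => (hchar t).comp hvt
  have := ProbabilityMeasure.tendsto_iff_forall_integral_tendsto.1 hP f
  refine this.congr' ?_
  filter_upwards [hvu] with n hn
  change ∫ y, f y ∂(μ (v n)) = ∫ y, f y ∂(μ (u n))
  rw [hn]
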